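/- Let G be a connected graph whose every block is an odd cycle, an edge, or a single vertex. Then G has a proper 3-coloring; moreover the coloring can be chosen so that all vertices outside the minimal connected subgraph containing all 2-connected blocks (the 'good' vertices) receive only colors 1 and 2. -/

import Mathlib

/-- A block of `G`: a maximal connected subgraph without a cut-vertex. -/
def IsBlock {V : Type*} (G : SimpleGraph V) (H : G.Subgraph) : Prop :=
  H.Connected ∧ (∀ v ∈ H.verts, ((H.deleteVerts {v}).coe).Preconnected) ∧
    ∀ H' : G.Subgraph, H ≤ H' → H'.Connected →
      (∀ v ∈ H'.verts, ((H'.deleteVerts {v}).coe).Preconnected) → H' = H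

/-- The set of bad vertices: those in the minimal connected vertex set
containing all 2-connected blocks of `G`. -/
def BadSet {V : Type*} (G : SimpleGraph V) : Set V :=
  ⋂₀ {S : Set V | (G.induce S).Connected ∧
      ∀ H : G.Subgraph, IsBlock G H → 3 ≤ H.verts.ncard → H.verts ⊆ S}

namespace SimpleGraph

variable {V : Type*} {G : SimpleGraph V}

namespace Subgraph

/-- Connectedness of a subgraph, expressed through reachability in its spanning coercion. -/
theorem coe_preconnected_iff_reachable_spanningCoe {H : G.Subgraph} :
    H.coe.Preconnected ↔ ∀ x ∈ H.verts, ∀ y ∈ H.verts, H.spanningCoe.Reachable x y := by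
  constructor
  · intro h x hx y hy
    let φ : H.coe →g H.spanningCoe := ⟨Subtype.val, id⟩
    exact (h ⟨x, hx⟩ ⟨y, hy⟩).map φ
  · rintro h ⟨x, hx⟩ ⟨y, hy⟩
    have lift : ∀ {a b : V} (p : H.spanningCoe.Walk a b) (ha : a ∈ H.verts) (hb : b ∈ H.verts),
        H.coe.Reachable ⟨a, ha⟩ ⟨b, hb⟩ := by
      intro a b p
      induction p with
      | nil => exact fun _ _ => Reachable.refl _
      | @cons a c b hac p ih =>
        intro ha hb
        have hadj : H.coe.Adj ⟨a, ha⟩ ⟨c, H.edge_vert hac.symm⟩ := hac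
        exact hadj.reachable.trans (ih _ hb)
    exact lift (h x hx y hy).some hx hy

/-- A nonempty subgraph that stays connected when at most one vertex is deleted. -/
def Nonseparable (H : G.Subgraph) : Prop :=
  H.verts.Nonempty ∧ ∀ S : Set V, S.Subsingleton → ∀ x ∈ H.verts \ S, ∀ y ∈ H.verts \ S,
    (H.deleteVerts S).spanningCoe.Reachable x y

theorem nonseparable_iff {H : G.Subgraph} :
    H.Nonseparable ↔
      H.Connected ∧ ∀ v ∈ H.verts, (H.deleteVerts {v}).coe.Preconnected := by
  constructor
  · rintro ⟨hne, h⟩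
    have := hne.to_subtype
    refine ⟨⟨⟨?_⟩⟩, fun v _ => ?_⟩
    · rw [coe_preconnected_iff_reachable_spanningCoe]
      simpa using h ∅ Set.subsingleton_empty
    · rw [coe_preconnected_iff_reachable_spanningCoe]
      exact h {v} Set.subsingleton_singleton
  · rintro ⟨hc, h⟩
    have hc' := coe_preconnected_iff_reachable_spanningCoe.1 hc.coe.preconnected
    refine ⟨hc.nonempty, fun S hS => ?_⟩
    obtain rfl | ⟨v, rfl⟩ := hS.eq_empty_or_singleton
    · simpa using hc'
    · by_cases hv : v ∈ H.verts
      · exact coe_preconnected_iff_reachable_spanningCoe.1 (h v hv)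
      · have hdel : H.deleteVerts {v} = H := by
          rw [← deleteVerts_inter_verts_left_eq, Set.inter_singleton_eq_empty.2 hv,
            deleteVerts_empty]
        rw [hdel]
        exact fun x hx y hy => hc' x hx.1 y hy.1

theorem reachable_deleteVerts_mono {H K : G.Subgraph} (h : H ≤ K) {S : Set V} {x y : V}
    (hxy : (H.deleteVerts S).spanningCoe.Reachable x y) :
    (K.deleteVerts S).spanningCoe.Reachable x y :=
  hxy.mono (spanningCoe_le_of_le (deleteVerts_mono h))

theorem Nonseparable.sup {H K : G.Subgraph} (hH : H.Nonseparable) (hK : K.Nonseparable)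
    {s t : V} (hst : s ≠ t) (hsH : s ∈ H.verts) (hsK : s ∈ K.verts) (htH : t ∈ H.verts)
    (htK : t ∈ K.verts) : (H ⊔ K).Nonseparable := by
  refine ⟨hH.1.mono (by simp), fun S hS => ?_⟩
  obtain ⟨a, haS, haH, haK⟩ : ∃ a, a ∉ S ∧ a ∈ H.verts ∧ a ∈ K.verts := by
    by_cases hs : s ∈ S
    · exact ⟨t, fun ht => hst (hS hs ht), htH, htK⟩
    · exact ⟨s, hs, hsH, hsK⟩
  have key : ∀ x ∈ (H ⊔ K).verts \ S, ((H ⊔ K).deleteVerts S).spanningCoe.Reachable x a := by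
    rintro x ⟨hx | hx, hxS⟩
    · exact reachable_deleteVerts_mono le_sup_left (hH.2 S hS x ⟨hx, hxS⟩ a ⟨haH, haS⟩)
    · exact reachable_deleteVerts_mono le_sup_right (hK.2 S hS x ⟨hx, hxS⟩ a ⟨haK, haS⟩)
  exact fun x hx y hy => (key x hx).trans (key y hy).symm

theorem Nonseparable.exists_isBlock_ge {K : G.Subgraph} (hK : K.Nonseparable) :
    ∃ H, K ≤ H ∧ IsBlock G H := by
  obtain ⟨H, hKH, hH⟩ := zorn_le_nonempty₀ {H : G.Subgraph | H.Nonseparable} (by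
    intro c hc hchain A hA
    refine ⟨sSup c, ⟨(hc hA).1.mono (le_sSup hA).1, fun S hS x hx y hy => ?_⟩,
      fun z hz => le_sSup hz⟩
    obtain ⟨hx, hxS⟩ := hx
    obtain ⟨hy, hyS⟩ := hy
    rw [verts_sSup, Set.mem_iUnion₂] at hx hy
    obtain ⟨A, hA, hxA⟩ := hx
    obtain ⟨B, hB, hyB⟩ := hy
    obtain ⟨C, hC, hAC, hBC⟩ := hchain.directedOn A hA B hB
    exact reachable_deleteVerts_mono (le_sSup hC)
      ((hc hC).2 S hS x ⟨hAC.1 hxA, hxS⟩ y ⟨hBC.1 hyB, hyS⟩)) K hK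
  obtain ⟨hconn, hdel⟩ := nonseparable_iff.1 hH.prop
  exact ⟨H, hKH, hconn, hdel, fun H' hle h₁ h₂ =>
    (hH.eq_of_le (nonseparable_iff.2 ⟨h₁, h₂⟩) hle).symm⟩

end Subgraph

theorem Walk.IsCycle.nonseparable_toSubgraph {u : V} {c : G.Walk u u} (hc : c.IsCycle) :
    c.toSubgraph.Nonseparable := by
  classical
  rw [Subgraph.nonseparable_iff]
  refine ⟨c.toSubgraph_connected, fun x hx => ?_⟩
  rw [Walk.mem_verts_toSubgraph] at hx
  rw [← Walk.toSubgraph_rotate c hx]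
  have hr : (c.rotate x hx).IsCycle := hc.rotate hx
  generalize c.rotate x hx = d at hr
  cases d with
  | nil => simp at hr
  | @cons _ y _ h p =>
    have hp : p.IsPath := ((Walk.cons_isCycle_iff p h).1 hr).1
    have hnil : ¬ p.Nil := Walk.not_nil_of_ne h.ne.symm
    have hsupp : p.support = p.dropLast.support ++ [x] :=
      (Walk.support_dropLast_concat hnil).symm
    have hxd : x ∉ p.dropLast.support := by
      have := hp.support_nodup
      rw [hsupp, List.nodup_append] at this
      grind
    have hle : p.dropLast.toSubgraph ≤ (Walk.cons h p).toSubgraph.deleteVerts {x} := by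
      have hverts : ∀ z ∈ p.dropLast.support, z ∈ (Walk.cons h p).support ∧ z ≠ x :=
        fun z hz => ⟨by simp [hsupp, hz], fun hzx => hxd (hzx ▸ hz)⟩
      refine ⟨fun z hz => ?_, fun a b hab => ?_⟩
      · rw [Walk.mem_verts_toSubgraph] at hz
        rw [Subgraph.deleteVerts_verts, Set.mem_sdiff, Walk.mem_verts_toSubgraph]
        exact hverts z hz
      · have hb := hverts b (Walk.mem_support_of_adj_toSubgraph hab.symm)
        have ha := hverts a (Walk.mem_support_of_adj_toSubgraph hab)
        rw [Walk.adj_toSubgraph_iff_mem_edges, Walk.edges_dropLast] at hab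
        have hadj : (Walk.cons h p).toSubgraph.Adj a b := by
          rw [Walk.adj_toSubgraph_iff_mem_edges, Walk.edges_cons]
          exact List.mem_cons_of_mem _ (List.mem_of_mem_dropLast hab)
        rw [Subgraph.deleteVerts_adj]
        simp only [Walk.mem_verts_toSubgraph, Set.mem_singleton_iff]
        exact ⟨ha.1, ha.2, hb.1, hb.2, hadj⟩
    refine (p.dropLast.toSubgraph_connected.mono hle ?_).coe.preconnected
    ext z
    rw [Subgraph.deleteVerts_verts, Set.mem_sdiff, Walk.mem_verts_toSubgraph,
      Walk.mem_verts_toSubgraph, Walk.support_cons, hsupp]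
    grind

theorem exists_isCycle_of_adj_of_walk {v a b : V} (ha : G.Adj v a) (hb : G.Adj v b)
    (hab : a ≠ b) (p : G.Walk a b) (hp : v ∉ p.support) :
    ∃ c : G.Walk v v, c.IsCycle ∧ c.toSubgraph.Adj v a ∧ c.toSubgraph.Adj v b := by
  classical
  have hv : v ∉ p.bypass.support := fun h => hp (p.support_bypass_subset_support h)
  refine ⟨.cons ha (p.bypass.concat hb.symm), ?_, ?_, ?_⟩
  · rw [Walk.cons_isCycle_iff]
    refine ⟨p.bypass_isPath.concat hv hb.symm, ?_⟩
    rw [Walk.edges_concat]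
    intro h
    rw [List.concat_eq_append, List.mem_append, List.mem_singleton, Sym2.eq_swap,
      Sym2.congr_left] at h
    exact h.elim (fun h => hv (p.bypass.snd_mem_support_of_mem_edges h)) hab
  · simp
  · simp [Walk.adj_toSubgraph_iff_mem_edges, Walk.edges_concat]

theorem Connected.exists_walk_notMem_support_of_dist_le (hG : G.Connected) {r v a : V}
    (hav : a ≠ v) (h : G.dist a r ≤ G.dist v r) : ∃ p : G.Walk a r, v ∉ p.support := by
  classical
  obtain ⟨p, hp⟩ := hG.exists_walk_length_eq_dist a r
  refine ⟨p, fun hv => ?_⟩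
  have h₁ := congrArg Walk.length (p.take_spec hv)
  rw [Walk.length_append] at h₁
  have h₂ := dist_le (p.dropUntil v hv)
  have h₃ : (p.takeUntil v hv).length ≠ 0 := fun h₀ => hav (Walk.eq_of_length_eq_zero h₀)
  omega

/-- Two neighbours of `v` that are no farther from `r` than `v` lie on a cycle through `v`. -/
theorem Connected.exists_isCycle_of_dist_le (hG : G.Connected) {r v a b : V}
    (ha : G.Adj v a) (hb : G.Adj v b) (hab : a ≠ b) (hda : G.dist a r ≤ G.dist v r)
    (hdb : G.dist b r ≤ G.dist v r) :
    ∃ c : G.Walk v v, c.IsCycle ∧ c.toSubgraph.Adj v a ∧ c.toSubgraph.Adj v b := by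
  obtain ⟨p, hp⟩ := hG.exists_walk_notMem_support_of_dist_le ha.ne' hda
  obtain ⟨q, hq⟩ := hG.exists_walk_notMem_support_of_dist_le hb.ne' hdb
  refine exists_isCycle_of_adj_of_walk ha hb hab (p.append q.reverse) ?_
  simp [Walk.mem_support_append_iff, hp, hq]

/-- A finite subgraph spanned by a cycle has no vertex with three neighbours. -/
theorem Subgraph.eq_or_eq_or_eq_of_isCycle {H : G.Subgraph} {w : H.verts} {c : H.coe.Walk w w}
    (hc : c.IsCycle) (hE : ∀ e ∈ H.coe.edgeSet, e ∈ c.edges) {v x y z : V}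
    (hx : H.Adj v x) (hy : H.Adj v y) (hz : H.Adj v z) : x = y ∨ x = z ∨ y = z := by
  have mem : ∀ {t} (ht : H.Adj v t), (⟨t, H.edge_vert ht.symm⟩ : H.verts) ∈
      c.toSubgraph.neighborSet ⟨v, H.edge_vert hx⟩ := by
    intro t ht
    rw [Subgraph.mem_neighborSet, Walk.adj_toSubgraph_iff_mem_edges]
    exact hE _ ht
  have htwo := hc.ncard_neighborSet_toSubgraph_eq_two
    (Walk.mem_support_of_adj_toSubgraph (mem hx))
  obtain ⟨s, t, -, hst⟩ := Set.ncard_eq_two.1 htwo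
  have h₁ := mem hx
  have h₂ := mem hy
  have h₃ := mem hz
  rw [hst] at h₁ h₂ h₃
  grind

/-- Greedy colouring along a well-founded relation: if every vertex has at most two earlier
neighbours, then there is a 3-colouring using the last colour only on vertices with two distinct
earlier neighbours. -/
theorem exists_coloring_of_earlier_neighbors {rel : V → V → Prop} (hwf : WellFounded rel)
    (htri : ∀ a b, a ≠ b → rel a b ∨ rel b a)
    (hrel : ∀ v a b c, G.Adj v a → G.Adj v b → G.Adj v c → rel a v → rel b v → rel c v →
      a = b ∨ a = c ∨ b = c) :
    ∃ f : G.Coloring (Fin 3), ∀ v, f v = 2 →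
      ∃ a b, a ≠ b ∧ G.Adj v a ∧ G.Adj v b ∧ rel a v ∧ rel b v := by
  classical
  let F : (v : V) → ((u : V) → rel u v → Fin 3) → Fin 3 := fun v g =>
    if ∀ u (h : rel u v), G.Adj v u → g u h ≠ 0 then 0
    else if ∀ u (h : rel u v), G.Adj v u → g u h ≠ 1 then 1 else 2
  let f : V → Fin 3 := hwf.fix F
  have hf : ∀ v, f v = if ∀ u, rel u v → G.Adj v u → f u ≠ 0 then 0
      else if ∀ u, rel u v → G.Adj v u → f u ≠ 1 then 1 else 2 := fun v => hwf.fix_eq F v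
  have htwo : ∀ v, f v = 2 → ∃ a b, (G.Adj v a ∧ rel a v ∧ f a = 0) ∧
      (G.Adj v b ∧ rel b v ∧ f b = 1) := by
    intro v hv
    have h₀ : ¬ ∀ u, rel u v → G.Adj v u → f u ≠ 0 := fun h => by
      simp [hf v, if_pos h] at hv
    have h₁ : ¬ ∀ u, rel u v → G.Adj v u → f u ≠ 1 := fun h => by
      rw [hf v, if_neg h₀, if_pos h] at hv
      simp at hv
    push Not at h₀ h₁
    obtain ⟨a, ha, hva, hfa⟩ := h₀
    obtain ⟨b, hb, hvb, hfb⟩ := h₁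
    exact ⟨a, b, ⟨hva, ha, hfa⟩, hvb, hb, hfb⟩
  have hproper : ∀ v u, G.Adj v u → rel u v → f v ≠ f u := by
    intro v u huv hr heq
    have hcases : f v = 0 ∨ f v = 1 ∨ f v = 2 := by
      generalize f v = k
      fin_cases k <;> simp
    rcases hcases with h | h | h
    · rw [h] at heq
      rw [hf v] at h
      split_ifs at h with h₀ h₁
      · exact h₀ u hr huv heq.symm
      · exact absurd h (by decide)
      · exact absurd h (by decide)
    · rw [h] at heq
      rw [hf v] at h
      split_ifs at h with h₀ h₁
      · exact absurd h (by decide)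
      · exact h₁ u hr huv heq.symm
      · exact absurd h (by decide)
    · obtain ⟨a, b, ⟨hva, ha, hfa⟩, hvb, hb, hfb⟩ := htwo v h
      rw [h] at heq
      rcases hrel v a b u hva hvb huv ha hb hr with rfl | rfl | rfl <;>
        grind
  refine ⟨Coloring.mk f fun {v u} huv => ?_, fun v hv => ?_⟩
  · rcases htri u v huv.ne' with h | h
    · exact hproper v u huv h
    · exact (hproper u v huv.symm h).symm
  · obtain ⟨a, b, ⟨hva, ha, hfa⟩, hvb, hb, hfb⟩ := htwo v hv
    refine ⟨a, b, ?_, hva, hvb, ha, hb⟩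
    rintro rfl
    simp [hfa] at hfb

end SimpleGraph

/-- A connected graph all of whose blocks are odd cycles, edges or single
vertices is properly 3-colorable with all good vertices receiving only the
first two colors. -/
theorem three_coloring_of_odd_cycle_blocks {V : Type*} (G : SimpleGraph V)
    (hconn : G.Connected)
    (hblocks : ∀ H : G.Subgraph, IsBlock G H →
      (∃ v, H.verts = {v} ∧ H.edgeSet = ∅) ∨
      (∃ u v, u ≠ v ∧ H.verts = {u, v} ∧ H.edgeSet = {s(u, v)}) ∨
      (∃ (w : H.verts) (c : H.coe.Walk w w), c.IsCycle ∧ Odd c.length ∧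
        (∀ x, x ∈ c.support) ∧ ∀ e ∈ H.coe.edgeSet, e ∈ c.edges)) :
    ∃ f : G.Coloring (Fin 3), ∀ v, v ∉ BadSet G → f v ≠ 2 := by
  have hcycle : ∀ {H : G.Subgraph} {v a b : V}, IsBlock G H → H.Adj v a → H.Adj v b → a ≠ b →
      ∃ (w : H.verts) (c : H.coe.Walk w w), c.IsCycle ∧
        (∀ x, x ∈ c.support) ∧ ∀ e ∈ H.coe.edgeSet, e ∈ c.edges := by
    intro H v a b hH ha hb hab
    have hv := ha.fst_mem
    have ha' := ha.snd_mem
    have hb' := hb.snd_mem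
    have hva := ha.ne
    have hvb := hb.ne
    rcases hblocks H hH with ⟨x, hx, -⟩ | ⟨x, y, -, hxy, -⟩ | ⟨w, c, hc, -, hsupp, hE⟩
    · rw [hx] at hv ha'
      exact absurd (hv.trans ha'.symm) hva
    · rw [hxy] at hv ha' hb'
      grind
    · exact ⟨w, c, hc, hsupp, hE⟩
  obtain ⟨r⟩ := hconn.nonempty
  let rel : V → V → Prop := InvImage (Prod.Lex (· < ·) WellOrderingRel) fun v => (G.dist v r, v)
  have hwf : WellFounded rel :=
    InvImage.wf _ (WellFounded.prod_lex wellFounded_lt WellOrderingRel.isWellOrder.wf)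
  have hdist : ∀ {a v}, rel a v → G.dist a r ≤ G.dist v r := fun h => by
    rcases Prod.lex_def.1 h with h | h
    · exact h.le
    · exact h.1.le
  have htri : ∀ a b, a ≠ b → rel a b ∨ rel b a := by
    intro a b hab
    rcases lt_trichotomy (G.dist a r) (G.dist b r) with h | h | h
    · exact .inl (Prod.Lex.left _ _ h)
    · rcases trichotomous_of WellOrderingRel a b with h' | h' | h'
      · exact .inl (Prod.lex_def.2 (.inr ⟨h, h'⟩))
      · exact absurd h' hab
      · exact .inr (Prod.lex_def.2 (.inr ⟨h.symm, h'⟩))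
    · exact .inr (Prod.Lex.left _ _ h)
  obtain ⟨f, hf⟩ := SimpleGraph.exists_coloring_of_earlier_neighbors hwf htri
    fun v a b c ha hb hc ra rb rc => by
      by_contra! hne
      obtain ⟨hab, hac, hbc⟩ := hne
      obtain ⟨p, hp, hpa, hpb⟩ :=
        hconn.exists_isCycle_of_dist_le ha hb hab (hdist ra) (hdist rb)
      obtain ⟨q, hq, hqa, hqc⟩ :=
        hconn.exists_isCycle_of_dist_le ha hc hac (hdist ra) (hdist rc)
      obtain ⟨H, hle, hH⟩ := (hp.nonseparable_toSubgraph.sup hq.nonseparable_toSubgraph ha.ne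
        hpa.fst_mem hqa.fst_mem hpa.snd_mem hqa.snd_mem).exists_isBlock_ge
      have hHa : H.Adj v a := hle.2 (.inl hpa)
      have hHb : H.Adj v b := hle.2 (.inl hpb)
      have hHc : H.Adj v c := hle.2 (.inr hqc)
      obtain ⟨w, c, hcyc, -, hE⟩ := hcycle hH hHa hHb hab
      rcases SimpleGraph.Subgraph.eq_or_eq_or_eq_of_isCycle hcyc hE hHa hHb hHc with h | h | h
      · exact hab h
      · exact hac h
      · exact hbc h
  refine ⟨f, fun v hv hfv => hv ?_⟩
  obtain ⟨a, b, hab, ha, hb, ra, rb⟩ := hf v hfv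
  obtain ⟨p, hp, hpa, hpb⟩ :=
    hconn.exists_isCycle_of_dist_le ha hb hab (hdist ra) (hdist rb)
  obtain ⟨H, hle, hH⟩ := hp.nonseparable_toSubgraph.exists_isBlock_ge
  have hHa : H.Adj v a := hle.2 hpa
  have hHb : H.Adj v b := hle.2 hpb
  rintro S ⟨-, hS⟩
  refine hS H hH ?_ hHa.fst_mem
  obtain ⟨w, c, -, hsupp, -⟩ := hcycle hH hHa hHb hab
  have hfin : H.verts.Finite := Set.finite_coe_iff.1 <|
    Set.finite_univ_iff.1 (c.support.finite_toSet.subset fun x _ => hsupp x)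
  have hcard : ({v, a, b} : Set V).ncard = 3 :=
    Set.ncard_eq_three.2 ⟨v, a, b, ha.ne, hb.ne, hab, rfl⟩
  rw [← hcard]
  refine Set.ncard_le_ncard ?_ hfin
  rintro x (rfl | rfl | rfl)
  · exact hHa.fst_mem
  · exact hHa.snd_mem
  · exact hHb.snd_mem
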